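/- Let k be a field of characteristic p > 0, G a finite group, and let M and N be finite-dimensional kG-modules that are absolutely indecomposable, i.e., K ⊗_k M and K ⊗_k N are indecomposable KG-modules for an algebraic closure K of k. Suppose the trivial kG-module k is a direct summand of M ⊗ N. Then: dim_k M is not divisible by p; N is isomorphic to M^∨; the multiplicity of k as a direct summand of M ⊗ N is exactly one; the unit η_M: k → M^∨ ⊗ M is a split monomorphism of kG-modules; and the trace map tr: M^∨ ⊗ M → k is a split epimorphism of kG-modules. -/

import Mathlib

open TensorProduct

section Defs

variable {k G : Type} [Field k] [Group G]

/-- A `kG`-linear map between two representations of `G` over `k`: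
a `k`-linear map commuting with the `G`-actions. -/
def Equivariant {V W : Type} [AddCommGroup V] [Module k V] [AddCommGroup W] [Module k W]
    (ρV : Representation k G V) (ρW : Representation k G W) (f : V →ₗ[k] W) : Prop :=
  ∀ g : G, f ∘ₗ ρV g = ρW g ∘ₗ f

/-- `ρU` is (isomorphic to) a direct summand of `ρM`, witnessed by an equivariant
split monomorphism. -/
def IsDirectSummandRep {U M : Type} [AddCommGroup U] [Module k U]
    [AddCommGroup M] [Module k M]
    (ρU : Representation k G U) (ρM : Representation k G M) : Prop :=
  ∃ (i : U →ₗ[k] M) (r : M →ₗ[k] U),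
    Equivariant ρU ρM i ∧ Equivariant ρM ρU r ∧ r ∘ₗ i = LinearMap.id

/-- A submodule is a subrepresentation if it is stable under the `G`-action. -/
def IsSubrep {V : Type} [AddCommGroup V] [Module k V] (ρ : Representation k G V)
    (p : Submodule k V) : Prop := ∀ g : G, ∀ x ∈ p, ρ g x ∈ p

/-- A representation is indecomposable if it is nonzero and not the direct sum of
two nonzero subrepresentations. -/
def IndecomposableRep {V : Type} [AddCommGroup V] [Module k V]
    (ρ : Representation k G V) : Prop :=
  Nontrivial V ∧ ¬ ∃ p q : Submodule k V,
    IsSubrep ρ p ∧ IsSubrep ρ q ∧ IsCompl p q ∧ p ≠ ⊥ ∧ q ≠ ⊥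

/-- The base change (extension of scalars) of a representation along a field
extension `k → K`. -/
noncomputable def bcRep (K : Type) [Field K] [Algebra k K] {V : Type} [AddCommGroup V]
    [Module k V] (ρ : Representation k G V) : Representation K G (K ⊗[k] V) :=
  (Module.End.baseChangeHom k K V).toRingHom.toMonoidHom.comp ρ

end Defs

/-- The unit `η : k → M∨ ⊗ M`, sending `1` to the tensor corresponding to the
identity of `M` under `M∨ ⊗ M ≅ End_k(M)`. -/
noncomputable def unitMap (k : Type) (V : Type) [Field k] [AddCommGroup V] [Module k V]
    [FiniteDimensional k V] : k →ₗ[k] Module.Dual k V ⊗[k] V :=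
  LinearMap.toSpanSingleton k _ ((dualTensorHomEquiv k V V).symm LinearMap.id)

namespace Equivariant

variable {k G U V W : Type} [Field k] [Group G] [AddCommGroup U] [Module k U]
  [AddCommGroup V] [Module k V] [AddCommGroup W] [Module k W]
  {ρU : Representation k G U} {ρV : Representation k G V} {ρW : Representation k G W}

lemma apply {f : V →ₗ[k] W} (hf : Equivariant ρV ρW f) (g : G) (x : V) :
    f (ρV g x) = ρW g (f x) :=
  LinearMap.congr_fun (hf g) x

lemma id : Equivariant ρV ρV LinearMap.id := fun _ => rfl

lemma comp {f : V →ₗ[k] W} {f' : U →ₗ[k] V} (hf : Equivariant ρV ρW f)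
    (hf' : Equivariant ρU ρV f') : Equivariant ρU ρW (f ∘ₗ f') := fun g => by
  rw [LinearMap.comp_assoc, hf' g, ← LinearMap.comp_assoc, hf g, LinearMap.comp_assoc]

lemma sub {f f' : V →ₗ[k] W} (hf : Equivariant ρV ρW f) (hf' : Equivariant ρV ρW f') :
    Equivariant ρV ρW (f - f') := fun g => by
  rw [LinearMap.sub_comp, LinearMap.comp_sub, hf g, hf' g]

lemma smul {f : V →ₗ[k] W} (c : k) (hf : Equivariant ρV ρW f) :
    Equivariant ρV ρW (c • f) := fun g => by
  rw [LinearMap.smul_comp, LinearMap.comp_smul, hf g]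

lemma pow {f : V →ₗ[k] V} (hf : Equivariant ρV ρV f) (n : ℕ) :
    Equivariant ρV ρV (f ^ n) := by
  induction n with
  | zero => exact id
  | succ n ih => rw [pow_succ]; exact ih.comp hf

lemma symm {e : V ≃ₗ[k] W} (he : Equivariant ρV ρW (e : V →ₗ[k] W)) :
    Equivariant ρW ρV (e.symm : W →ₗ[k] V) := fun g => by
  ext x
  apply e.injective
  simpa using (he.apply g (e.symm x)).symm

lemma isSubrep_ker {f : V →ₗ[k] W} (hf : Equivariant ρV ρW f) :
    IsSubrep ρV (LinearMap.ker f) := fun g x hx => by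
  rw [LinearMap.mem_ker] at hx ⊢
  rw [hf.apply, hx, map_zero]

lemma isSubrep_range {f : V →ₗ[k] W} (hf : Equivariant ρV ρW f) :
    IsSubrep ρW (LinearMap.range f) := by
  rintro g _ ⟨x, rfl⟩
  exact ⟨ρV g x, hf.apply g x⟩

lemma baseChange (K : Type) [Field K] [Algebra k K] {f : V →ₗ[k] V}
    (hf : Equivariant ρV ρV f) :
    Equivariant (bcRep K ρV) (bcRep K ρV) (f.baseChange K) := fun g => by
  change f.baseChange K ∘ₗ (ρV g).baseChange K = (ρV g).baseChange K ∘ₗ f.baseChange K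
  rw [← LinearMap.baseChange_comp, hf g, LinearMap.baseChange_comp]

end Equivariant

namespace IndecomposableRep

variable {k G V : Type} [Field k] [Group G] [AddCommGroup V] [Module k V]
  [FiniteDimensional k V] {ρ : Representation k G V}

/-- **Fitting's lemma** for indecomposable representations. -/
lemma isNilpotent_or_injective (hρ : IndecomposableRep ρ) {f : Module.End k V}
    (hf : Equivariant ρ ρ f) : IsNilpotent f ∨ Function.Injective f := by
  obtain ⟨n, hn, hn0⟩ := ((LinearMap.eventually_isCompl_ker_pow_range_pow f).and
    (Filter.eventually_ge_atTop 1)).exists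
  by_cases hker : LinearMap.ker (f ^ n) = ⊥
  · refine Or.inr (LinearMap.ker_eq_bot.mp (le_bot_iff.mp (hker ▸ ?_)))
    obtain ⟨m, rfl⟩ := Nat.exists_eq_add_of_le' hn0
    intro x hx
    rw [LinearMap.mem_ker] at hx ⊢
    rw [pow_succ, Module.End.mul_apply, hx, map_zero]
  · refine Or.inl ⟨n, LinearMap.range_eq_bot.mp ?_⟩
    by_contra hrange
    exact hρ.2 ⟨_, _, (hf.pow n).isSubrep_ker, (hf.pow n).isSubrep_range, hn, hker, hrange⟩

lemma injective_of_trace_ne_zero (hρ : IndecomposableRep ρ) {f : Module.End k V}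
    (hf : Equivariant ρ ρ f) (htr : LinearMap.trace k V f ≠ 0) : Function.Injective f :=
  (hρ.isNilpotent_or_injective hf).resolve_left fun hnil =>
    htr (LinearMap.isNilpotent_trace_of_isNilpotent hnil).eq_zero

/-- Over an algebraically closed field, an endomorphism of an indecomposable representation
acts on traces as a scalar. -/
lemma exists_trace_mul_eq [IsAlgClosed k] (hρ : IndecomposableRep ρ) {f : Module.End k V}
    (hf : Equivariant ρ ρ f) :
    ∃ c : k, ∀ x : Module.End k V, Equivariant ρ ρ x →
      LinearMap.trace k V (f * x) = c * LinearMap.trace k V x := by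
  have := hρ.1
  obtain ⟨c, hc⟩ := Module.End.exists_eigenvalue f
  refine ⟨c, fun x hx => ?_⟩
  have hfc : Equivariant ρ ρ (f - c • LinearMap.id) := hf.sub (Equivariant.id.smul c)
  have hzero : LinearMap.trace k V ((f - c • LinearMap.id) * x) = 0 := by
    by_contra hne
    have hinj := hρ.injective_of_trace_ne_zero (hfc.comp hx) hne
    have hsurj := LinearMap.surjective_of_injective hinj
    rw [LinearMap.coe_comp] at hsurj
    have hinj' : Function.Injective (f - c • LinearMap.id : V →ₗ[k] V) :=
      LinearMap.injective_iff_surjective.mpr hsurj.of_comp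
    obtain ⟨v, hv⟩ := hc.exists_hasEigenvector
    refine hv.2 (hinj' ?_)
    simp [hv.apply_eq_smul]
  rw [sub_mul, map_sub, sub_eq_zero] at hzero
  rw [hzero, smul_mul_assoc, map_smul, smul_eq_mul]
  rfl

end IndecomposableRep

section AbsolutelyIndecomposable

variable {k G V : Type} [Field k] [Group G] [AddCommGroup V] [Module k V]
  [FiniteDimensional k V] {ρ : Representation k G V} {K : Type} [Field K] [Algebra k K]

lemma injective_of_trace_ne_zero_of_baseChange (hρ : IndecomposableRep (bcRep K ρ))
    {f : Module.End k V} (hf : Equivariant ρ ρ f) (htr : LinearMap.trace k V f ≠ 0) :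
    Function.Injective f := by
  have hinj : Function.Injective (f.baseChange K) := by
    refine hρ.injective_of_trace_ne_zero (hf.baseChange K) ?_
    rw [LinearMap.trace_baseChange]
    simpa using htr
  rw [injective_iff_map_eq_zero]
  intro v hv
  apply Module.FaithfullyFlat.tensorProduct_mk_injective (A := k) (B := K) V
  apply hinj
  simp [hv]

lemma exists_trace_mul_eq_of_baseChange [IsAlgClosed K] (hρ : IndecomposableRep (bcRep K ρ))
    {f : Module.End k V} (hf : Equivariant ρ ρ f) :
    ∃ c : K, ∀ x : Module.End k V, Equivariant ρ ρ x →
      algebraMap k K (LinearMap.trace k V (f * x)) =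
        c * algebraMap k K (LinearMap.trace k V x) := by
  obtain ⟨c, hc⟩ := hρ.exists_trace_mul_eq (hf.baseChange K)
  refine ⟨c, fun x hx => ?_⟩
  rw [← LinearMap.trace_baseChange, ← LinearMap.trace_baseChange, ← hc _ (hx.baseChange K),
    LinearMap.baseChange_mul]

lemma finrank_ne_zero_of_trace_ne_zero [IsAlgClosed K] (hρ : IndecomposableRep (bcRep K ρ))
    {f : Module.End k V} (hf : Equivariant ρ ρ f) (htr : LinearMap.trace k V f ≠ 0) :
    (Module.finrank k V : k) ≠ 0 := by
  intro h0
  obtain ⟨c, hc⟩ := exists_trace_mul_eq_of_baseChange hρ hf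
  have h1 := hc 1 Equivariant.id
  rw [mul_one, LinearMap.trace_one, h0, map_zero, mul_zero] at h1
  exact htr ((map_eq_zero _).mp h1)

end AbsolutelyIndecomposable

section Pairing

variable {k G M N : Type} [Field k] [Group G] [AddCommGroup M] [Module k M]
  [AddCommGroup N] [Module k N] {ρM : Representation k G M} {ρN : Representation k G N}

variable (k M N) in
/-- A tensor in `M ⊗ N` as a map `M∨ → N`, contracting the first factor. -/
noncomputable def contractFst : M ⊗[k] N →ₗ[k] Module.Dual k M →ₗ[k] N :=
  TensorProduct.lift (LinearMap.smulRightₗ ∘ₗ Module.Dual.eval k M)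

@[simp]
lemma contractFst_tmul (m : M) (n : N) (f : Module.Dual k M) :
    contractFst k M N (m ⊗ₜ n) f = f m • n := rfl

lemma contractFst_tprod (g : G) (v : M ⊗[k] N) (f : Module.Dual k M) :
    contractFst k M N (ρM.tprod ρN g v) f = ρN g (contractFst k M N v (f ∘ₗ ρM g)) := by
  induction v with
  | zero => simp
  | add x y hx hy => simp only [map_add, LinearMap.add_apply, hx, hy]
  | tmul m n => simp [Representation.tprod_apply]

lemma equivariant_contractFst {v : M ⊗[k] N} (hv : ∀ g, ρM.tprod ρN g v = v) :
    Equivariant ρM.dual ρN (contractFst k M N v) := fun g => by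
  ext f
  have h := contractFst_tprod (ρM := ρM) (ρN := ρN) g v (f ∘ₗ ρM g⁻¹)
  rw [hv g, LinearMap.comp_assoc, ← Module.End.mul_eq_comp, ← map_mul, inv_mul_cancel, map_one,
    Module.End.one_eq_id, LinearMap.comp_id] at h
  exact h

lemma equivariant_flip_curry {r : M ⊗[k] N →ₗ[k] k}
    (hr : ∀ g t, r (ρM.tprod ρN g t) = r t) :
    Equivariant ρN ρM.dual (TensorProduct.curry r).flip := fun g => by
  ext n m
  have h := hr g (ρM g⁻¹ m ⊗ₜ n)
  simpa [Representation.tprod_apply, Representation.dual_apply, Module.Dual.transpose_apply]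
    using h

lemma trace_contractFst_comp_flip_curry [FiniteDimensional k N] (r : M ⊗[k] N →ₗ[k] k)
    (v : M ⊗[k] N) :
    LinearMap.trace k N (contractFst k M N v ∘ₗ (TensorProduct.curry r).flip) = r v := by
  induction v with
  | zero => simp
  | add x y hx hy => simp only [map_add, LinearMap.add_comp, hx, hy]
  | tmul m n =>
    have h : contractFst k M N (m ⊗ₜ n) ∘ₗ (TensorProduct.curry r).flip =
        dualTensorHom k N N (TensorProduct.curry r m ⊗ₜ n) := by
      ext; simp
    rw [h, LinearMap.trace_eq_contract_apply]
    simp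

lemma IsDirectSummandRep.exists_invariant
    (h : IsDirectSummandRep (Representation.trivial k (G := G) (V := k)) (ρM.tprod ρN)) :
    ∃ (v : M ⊗[k] N) (r : M ⊗[k] N →ₗ[k] k), (∀ g, ρM.tprod ρN g v = v) ∧
      (∀ g t, r (ρM.tprod ρN g t) = r t) ∧ r v = 1 := by
  obtain ⟨i, r, hi, hr, hri⟩ := h
  exact ⟨i 1, r, fun g => (hi.apply g 1).symm, fun g t => hr.apply g t,
    LinearMap.congr_fun hri 1⟩

lemma tprod_comm (g : G) (t : N ⊗[k] M) :
    TensorProduct.comm k N M (ρN.tprod ρM g t) =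
      ρM.tprod ρN g (TensorProduct.comm k N M t) := by
  induction t with
  | zero => simp
  | add x y hx hy => simp only [map_add, hx, hy]
  | tmul n m => simp [Representation.tprod_apply]

lemma equivariant_contractLeft :
    Equivariant (V := Module.Dual k M ⊗[k] M) (ρM.dual.tprod ρM)
      (Representation.trivial k (G := G) (V := k)) (contractLeft k M) := fun g => by
  ext f m
  simp [Representation.tprod_apply, Representation.dual_apply, Module.Dual.transpose_apply]

@[simp]
lemma dualTensorHom_unitMap_one [FiniteDimensional k M] :
    dualTensorHom k M M (unitMap k M 1) = LinearMap.id := by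
  rw [unitMap, LinearMap.toSpanSingleton_apply, one_smul]
  exact (dualTensorHomEquiv k M M).apply_symm_apply LinearMap.id

lemma equivariant_unitMap [FiniteDimensional k M] :
    Equivariant (W := Module.Dual k M ⊗[k] M)
      (Representation.trivial k (G := G) (V := k)) (ρM.dual.tprod ρM) (unitMap k M) := fun g => by
  ext
  apply (dualTensorHomEquiv k M M).injective
  have h := LinearMap.congr_fun (Representation.dualTensorHom_comm ρM ρM g) (unitMap k M 1)
  rw [LinearMap.comp_apply, LinearMap.comp_apply, dualTensorHom_unitMap_one,
    Representation.linHom_apply, LinearMap.id_comp, ← Module.End.mul_eq_comp, ← map_mul,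
    mul_inv_cancel, map_one ρM] at h
  exact dualTensorHom_unitMap_one.trans h.symm

lemma contractLeft_unitMap_one [FiniteDimensional k M] :
    contractLeft k M (unitMap k M 1) = Module.finrank k M := by
  rw [← LinearMap.trace_eq_contract_apply, dualTensorHom_unitMap_one, LinearMap.trace_id]

end Pairing

section InvariantForm

variable {k G M N K : Type} [Field k] [Group G] [AddCommGroup M] [Module k M]
  [AddCommGroup N] [Module k N] [FiniteDimensional k N]
  {ρM : Representation k G M} {ρN : Representation k G N} [Field K] [Algebra k K]
  {v : M ⊗[k] N} {r : M ⊗[k] N →ₗ[k] k}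

lemma injective_flip_curry_of_apply_ne_zero (hN : IndecomposableRep (bcRep K ρN))
    (hv : ∀ g, ρM.tprod ρN g v = v) (hr : ∀ g t, r (ρM.tprod ρN g t) = r t) (hrv : r v ≠ 0) :
    Function.Injective (TensorProduct.curry r).flip := by
  rw [← trace_contractFst_comp_flip_curry] at hrv
  exact Function.Injective.of_comp (injective_of_trace_ne_zero_of_baseChange hN
    ((equivariant_contractFst hv).comp (equivariant_flip_curry hr)) hrv)

lemma finrank_ne_zero_of_apply_ne_zero [IsAlgClosed K] (hN : IndecomposableRep (bcRep K ρN))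
    (hv : ∀ g, ρM.tprod ρN g v = v) (hr : ∀ g t, r (ρM.tprod ρN g t) = r t) (hrv : r v ≠ 0) :
    (Module.finrank k N : k) ≠ 0 := by
  rw [← trace_contractFst_comp_flip_curry] at hrv
  exact finrank_ne_zero_of_trace_ne_zero hN
    ((equivariant_contractFst hv).comp (equivariant_flip_curry hr)) hrv

/-- If an invariant form `r` on `M ⊗ N` identifies `N` with `M∨`, then every invariant form on
`M ⊗ N` is, on invariant tensors, a scalar multiple of `r`. -/
lemma exists_apply_eq_mul_of_bijective [IsAlgClosed K] (hN : IndecomposableRep (bcRep K ρN))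
    (hr : ∀ g t, r (ρM.tprod ρN g t) = r t)
    (hbij : Function.Bijective (TensorProduct.curry r).flip)
    {r' : M ⊗[k] N →ₗ[k] k} (hr' : ∀ g t, r' (ρM.tprod ρN g t) = r' t) :
    ∃ c : K, ∀ v, (∀ g, ρM.tprod ρN g v = v) →
      algebraMap k K (r' v) = c * algebraMap k K (r v) := by
  let e := LinearEquiv.ofBijective _ hbij
  have he : Equivariant ρN ρM.dual (e : N →ₗ[k] Module.Dual k M) := equivariant_flip_curry hr
  obtain ⟨c, hc⟩ := exists_trace_mul_eq_of_baseChange hN (he.symm.comp (equivariant_flip_curry hr'))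
  refine ⟨c, fun v hv => ?_⟩
  rw [← trace_contractFst_comp_flip_curry r, ← trace_contractFst_comp_flip_curry r',
    ← hc _ ((equivariant_contractFst hv).comp (equivariant_flip_curry hr)),
    LinearMap.trace_mul_comm]
  congr 2
  ext n
  have h : (TensorProduct.curry r).flip (e.symm ((TensorProduct.curry r').flip n)) =
    (TensorProduct.curry r').flip n := e.apply_symm_apply _
  simp only [Module.End.mul_apply, LinearMap.comp_apply, LinearEquiv.coe_coe, h]

end InvariantForm

/-- Benson--Carlson: if `M` and `N` are absolutely indecomposable finite-dimensional
`kG`-modules and the trivial module `k` is a direct summand of `M ⊗ N`, then `dim M` is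
prime to `p`, `N ≅ M∨`, the multiplicity of `k` in `M ⊗ N` is exactly one (i.e. `k × k`
is not a direct summand), the unit `η : k → M∨ ⊗ M` is a split monomorphism and the
trace `M∨ ⊗ M → k` is a split epimorphism. -/
theorem benson_carlson_trivial_summand_of_tensor
    (p : ℕ) (hp : p.Prime) (k : Type) [Field k] [CharP k p]
    (G : Type) [Group G] [Finite G]
    (K : Type) [Field K] [Algebra k K] [IsAlgClosure k K]
    (M N : Type) [AddCommGroup M] [Module k M] [FiniteDimensional k M]
    [AddCommGroup N] [Module k N] [FiniteDimensional k N]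
    (ρM : Representation k G M) (ρN : Representation k G N)
    (hM : IndecomposableRep (bcRep K ρM)) (hN : IndecomposableRep (bcRep K ρN))
    (h : IsDirectSummandRep (Representation.trivial k (G := G) (V := k))
          (ρM.tprod ρN)) :
    ¬ (p ∣ Module.finrank k M) ∧
    (∃ e : N ≃ₗ[k] Module.Dual k M,
      Equivariant ρN ρM.dual (e : N →ₗ[k] Module.Dual k M)) ∧
    ¬ IsDirectSummandRep (Representation.trivial k (G := G) (V := k × k))
        (ρM.tprod ρN) ∧
    (∃ r : Module.Dual k M ⊗[k] M →ₗ[k] k,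
      Equivariant (V := Module.Dual k M ⊗[k] M)
        (ρM.dual.tprod ρM) (Representation.trivial k (G := G) (V := k)) r ∧
      r ∘ₗ unitMap k M = LinearMap.id) ∧
    (∃ s : k →ₗ[k] Module.Dual k M ⊗[k] M,
      Equivariant (W := Module.Dual k M ⊗[k] M)
        (Representation.trivial k (G := G) (V := k)) (ρM.dual.tprod ρM) s ∧
      contractLeft k M ∘ₗ s = LinearMap.id) := by
  have : IsAlgClosed K := IsAlgClosure.isAlgClosed k
  obtain ⟨v, r, hv, hr, hrv⟩ := h.exists_invariant
  have hrv' : r v ≠ 0 := hrv ▸ one_ne_zero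
  let c := TensorProduct.comm k N M
  have hvc (g : G) : ρN.tprod ρM g (c.symm v) = c.symm v := by
    apply c.injective
    rw [tprod_comm, c.apply_symm_apply, hv]
  have hrc (g : G) (t : N ⊗[k] M) : (r ∘ₗ c.toLinearMap) (ρN.tprod ρM g t) =
      (r ∘ₗ c.toLinearMap) t := by
    simp only [LinearMap.comp_apply, LinearEquiv.coe_coe]
    rw [tprod_comm, hr]
  have hrvc : (r ∘ₗ c.toLinearMap) (c.symm v) ≠ 0 := by simpa using hrv'
  have hdim : (Module.finrank k M : k) ≠ 0 := finrank_ne_zero_of_apply_ne_zero hM hvc hrc hrvc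
  have hinj := injective_flip_curry_of_apply_ne_zero hN hv hr hrv'
  have hinj' := injective_flip_curry_of_apply_ne_zero hM hvc hrc hrvc
  have hbij : Function.Bijective (TensorProduct.curry r).flip := by
    refine ⟨hinj, (LinearMap.injective_iff_surjective_of_finrank_eq_finrank ?_).mp hinj⟩
    have h1 := LinearMap.finrank_le_finrank_of_injective hinj
    have h2 := LinearMap.finrank_le_finrank_of_injective hinj'
    rw [Subspace.dual_finrank_eq] at h1 h2 ⊢
    exact le_antisymm h1 h2
  refine ⟨fun hdvd => hdim ((CharP.cast_eq_zero_iff k p _).mpr hdvd),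
    ⟨LinearEquiv.ofBijective _ hbij, equivariant_flip_curry hr⟩, ?_,
    ⟨(Module.finrank k M : k)⁻¹ • contractLeft k M, equivariant_contractLeft.smul _, ?_⟩,
    ⟨(Module.finrank k M : k)⁻¹ • unitMap k M, equivariant_unitMap.smul _, ?_⟩⟩
  · rintro ⟨i, q, hi, hq, hqi⟩
    have hinv (x : k × k) (g : G) : ρM.tprod ρN g (i x) = i x := (hi.apply g x).symm
    have hqi' (x : k × k) : q (i x) = x := LinearMap.congr_fun hqi x
    obtain ⟨a, ha⟩ := exists_apply_eq_mul_of_bijective hN hr hbij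
      (r' := LinearMap.fst k k k ∘ₗ q) fun g t => congrArg Prod.fst (hq.apply g t)
    obtain ⟨b, hb⟩ := exists_apply_eq_mul_of_bijective hN hr hbij
      (r' := LinearMap.snd k k k ∘ₗ q) fun g t => congrArg Prod.snd (hq.apply g t)
    have ha1 := ha _ (hinv (1, 0))
    have ha2 := ha _ (hinv (0, 1))
    have hb2 := hb _ (hinv (0, 1))
    simp only [LinearMap.comp_apply, hqi', LinearMap.fst_apply, LinearMap.snd_apply, map_one,
      map_zero] at ha1 ha2 hb2
    rcases mul_eq_zero.mp ha2.symm with h0 | h0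
    · rw [h0, zero_mul] at ha1
      exact one_ne_zero ha1
    · rw [h0, mul_zero] at hb2
      exact one_ne_zero hb2
  · ext
    simp [contractLeft_unitMap_one, hdim]
  · ext
    simp [contractLeft_unitMap_one, hdim]
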